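/- arXiv:1607.02523 — 6 statements merged into one kernel-verified Lean document; each statement's English description precedes it below -/
import Mathlib

section
/- Let ω₀ > 0, L₀ > 0 and let M, M_ω, M_A, F_ω, F_A be real numbers satisfying F_ω = ω₀M_ω + M, F_A = ω₀M_A + L₀, and L₀ = −ω₀M_A + M_ω. Then the determinant det(D) = F_A·M_ω − F_ω·M_A equals (L₀/ω₀)(ω₀ − M/L₀)·M_ω + M·L₀/ω₀. In particular, if M/L₀ > ω₀ > 0 and M_ω < 0, then det(D) ≠ 0 (indeed det(D) > 0). -/
/-- Under the three linear relations `F_ω = ω₀M_ω + M`,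
`F_A = ω₀M_A + L₀`, `L₀ = −ω₀M_A + M_ω`, the determinant
`det(D) = F_A·M_ω − F_ω·M_A` equals `(L₀/ω₀)(ω₀ − M/L₀)·M_ω + M·L₀/ω₀`; in
particular, if `M/L₀ > ω₀ > 0` and `M_ω < 0` then `det(D) ≠ 0` (indeed
`det(D) > 0`). -/
theorem stmt_4 (ω₀ L₀ M Mω MA Fω FA : ℝ) (hω₀ : 0 < ω₀) (hL₀ : 0 < L₀)
    (h1 : Fω = ω₀ * Mω + M) (h2 : FA = ω₀ * MA + L₀) (h3 : L₀ = -ω₀ * MA + Mω) :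
    FA * Mω - Fω * MA = L₀ / ω₀ * (ω₀ - M / L₀) * Mω + M * L₀ / ω₀ ∧
      (M / L₀ > ω₀ → Mω < 0 →
        FA * Mω - Fω * MA ≠ 0 ∧ FA * Mω - Fω * MA > 0) := by
  have hdet : FA * Mω - Fω * MA = L₀ / ω₀ * (ω₀ - M / L₀) * Mω + M * L₀ / ω₀ := by
    have hMω : Mω = L₀ + ω₀ * MA := by linarith
    rw [h1, h2, hMω]
    field_simp
    ring
  refine ⟨hdet, fun hM hneg => ?_⟩
  have hMpos : 0 < M := (div_pos_iff_of_pos_right hL₀).1 (hω₀.trans hM)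
  have hpos : FA * Mω - Fω * MA > 0 := by
    rw [hdet]
    have hcoeff : L₀ / ω₀ * (ω₀ - M / L₀) < 0 :=
      mul_neg_of_pos_of_neg (by positivity) (sub_neg.2 hM)
    exact add_pos (mul_pos_of_neg_of_neg hcoeff hneg) (by positivity)
  exact ⟨hpos.ne', hpos⟩
end

section
/- Let L₀ > 0, ω₀ ∈ ℝ, and let ψ, η, β : ℝ → ℝ be smooth L₀-periodic functions with η'''' − η'' + ω₀η + ψ − ψη = 0 and β'''' − β'' + ω₀β − ψβ + 1 = 0 on ℝ. For x₀, y₀ ∈ ℝ set Φ = x₀η + y₀β and ℒΦ = Φ'''' − Φ'' + ω₀Φ − ψΦ. Then: (i) ℒΦ(x) = −(x₀ψ(x) + y₀) for all x; (ii) for every smooth L₀-periodic φ with ∫₀^{L₀} ψφ dx = 0 and ∫₀^{L₀} φ dx = 0, one has ∫₀^{L₀} (ℒΦ)φ dx = 0; (iii) ∫₀^{L₀} (ℒΦ)Φ dx = −P(x₀,y₀), where P(x,y) = x²F_ω + xy(F_A + M_ω) + y²M_A with F_ω = ∫₀^{L₀} ψη dx, M_ω = ∫₀^{L₀} η dx,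 F_A = ∫₀^{L₀} ψβ dx, M_A = ∫₀^{L₀} β dx. In particular, if P(x₀,y₀) > 0 then ∫₀^{L₀} (ℒΦ)Φ dx < 0. -/
open intervalIntegral

/-- Iterated derivatives commute with linear combinations of smooth functions. -/
lemma iteratedDeriv_linear_comb {f g : ℝ → ℝ} (n : ℕ) (hf : ContDiff ℝ n f)
    (hg : ContDiff ℝ n g) (a b x : ℝ) :
    iteratedDeriv n (fun t => a * f t + b * g t) x =
      a * iteratedDeriv n f x + b * iteratedDeriv n g x := by
  rw [iteratedDeriv_fun_add (contDiff_const.mul hf).contDiffAt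
    (contDiff_const.mul hg).contDiffAt,
    iteratedDeriv_const_mul_field, iteratedDeriv_const_mul_field]

/-- The interval integral of a linear combination of continuous functions. -/
lemma integral_linear_comb {f g : ℝ → ℝ} (hf : Continuous f) (hg : Continuous g)
    (x y a b : ℝ) :
    (∫ s in a..b, (x * f s + y * g s)) = x * (∫ s in a..b, f s) + y * ∫ s in a..b, g s := by
  rw [integral_add ((hf.const_mul x).intervalIntegrable a b)
    ((hg.const_mul y).intervalIntegrable a b), integral_const_mul, integral_const_mul]

/-- With `ℒη = −ψ`, `ℒβ = −1` and `Φ = x₀η + y₀β`, one has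
(i) `ℒΦ = −(x₀ψ + y₀)`, (ii) `⟨ℒΦ, φ⟩ = 0` for every smooth periodic `φ`
orthogonal to `ψ` and to `1`, (iii) `⟨ℒΦ, Φ⟩ = −P(x₀, y₀)`; in particular,
if `P(x₀, y₀) > 0` then `⟨ℒΦ, Φ⟩ < 0`. -/
theorem stmt_5 (L₀ ω₀ : ℝ) (hL₀ : 0 < L₀) (ψ η β : ℝ → ℝ)
    (hψs : ContDiff ℝ (⊤ : ℕ∞) ψ) (hηs : ContDiff ℝ (⊤ : ℕ∞) η) (hβs : ContDiff ℝ (⊤ : ℕ∞) β)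
    (hψp : Function.Periodic ψ L₀) (hηp : Function.Periodic η L₀)
    (hβp : Function.Periodic β L₀)
    (heqη : ∀ x : ℝ,
      iteratedDeriv 4 η x - iteratedDeriv 2 η x + ω₀ * η x + ψ x - ψ x * η x = 0)
    (heqβ : ∀ x : ℝ,
      iteratedDeriv 4 β x - iteratedDeriv 2 β x + ω₀ * β x - ψ x * β x + 1 = 0)
    (x₀ y₀ : ℝ) (Φ LΦ : ℝ → ℝ)
    (hΦ : ∀ x : ℝ, Φ x = x₀ * η x + y₀ * β x)
    (hLΦ : ∀ x : ℝ,
      LΦ x = iteratedDeriv 4 Φ x - iteratedDeriv 2 Φ x + ω₀ * Φ x - ψ x * Φ x)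
    (P : ℝ → ℝ → ℝ)
    (hP : ∀ x y : ℝ, P x y =
      x ^ 2 * (∫ s in (0:ℝ)..L₀, ψ s * η s) +
        x * y * ((∫ s in (0:ℝ)..L₀, ψ s * β s) + ∫ s in (0:ℝ)..L₀, η s) +
        y ^ 2 * ∫ s in (0:ℝ)..L₀, β s) :
    (∀ x : ℝ, LΦ x = -(x₀ * ψ x + y₀)) ∧
      (∀ φ : ℝ → ℝ, ContDiff ℝ (⊤ : ℕ∞) φ → Function.Periodic φ L₀ →
        (∫ x in (0:ℝ)..L₀, ψ x * φ x) = 0 → (∫ x in (0:ℝ)..L₀, φ x) = 0 →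
        (∫ x in (0:ℝ)..L₀, LΦ x * φ x) = 0) ∧
      (∫ x in (0:ℝ)..L₀, LΦ x * Φ x) = -P x₀ y₀ ∧
      (P x₀ y₀ > 0 → (∫ x in (0:ℝ)..L₀, LΦ x * Φ x) < 0) := by
  have hL : ∀ x : ℝ, LΦ x = -(x₀ * ψ x + y₀) := by
    intro x
    have hΦ' : Φ = fun t => x₀ * η t + y₀ * β t := funext hΦ
    have hd (n : ℕ) : iteratedDeriv n Φ x =
        x₀ * iteratedDeriv n η x + y₀ * iteratedDeriv n β x := by
      rw [hΦ']
      exact iteratedDeriv_linear_comb n (hηs.of_le (by exact_mod_cast le_top))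
        (hβs.of_le (by exact_mod_cast le_top)) x₀ y₀ x
    rw [hLΦ, hd, hd, hΦ]
    linear_combination x₀ * heqη x + y₀ * heqβ x
  have hpair (φ : ℝ → ℝ) (hφ : Continuous φ) : (∫ x in (0:ℝ)..L₀, LΦ x * φ x) =
      -(x₀ * (∫ x in (0:ℝ)..L₀, ψ x * φ x) + y₀ * ∫ x in (0:ℝ)..L₀, φ x) := by
    rw [← integral_linear_comb (f := fun x => ψ x * φ x) (hψs.continuous.mul hφ) hφ, ← integral_neg]
    exact integral_congr fun s _ => by simp only [hL]; ring
  have hquad : (∫ x in (0:ℝ)..L₀, LΦ x * Φ x) = -P x₀ y₀ := by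
    have hη := hηs.continuous
    have hβ := hβs.continuous
    have hLΦc : Continuous LΦ := by
      rw [funext hL]
      exact ((hψs.continuous.const_mul x₀).add continuous_const).neg
    have hsplit : (∫ x in (0:ℝ)..L₀, LΦ x * Φ x) =
        x₀ * (∫ x in (0:ℝ)..L₀, LΦ x * η x) + y₀ * ∫ x in (0:ℝ)..L₀, LΦ x * β x := by
      rw [← integral_linear_comb (f := fun x => LΦ x * η x) (g := fun x => LΦ x * β x)
        (hLΦc.mul hη) (hLΦc.mul hβ)]
      exact integral_congr fun s _ => by simp only [hΦ]; ring
    rw [hsplit, hpair η hη, hpair β hβ, hP]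
    ring
  refine ⟨hL, fun φ hφ _ h1 h2 => ?_, hquad, fun h => ?_⟩
  · rw [hpair φ hφ.continuous, h1, h2]
    ring
  · rw [hquad]
    exact neg_neg_of_pos h
end

section
/- For every a > 0, the function f(x) = x / sinh(ax) is positive on (0, ∞) and logarithmically concave on (0, ∞): for all x, y ∈ (0, ∞) and all t ∈ [0, 1], f(tx + (1 − t)y) ≥ f(x)^t · f(y)^{1−t}. -/
open Real Set

theorem concaveOn_log_sub_log_sinh_mul {a : ℝ} (ha : 0 < a) :
    ConcaveOn ℝ (Ioi 0) fun x => log x - log (sinh (a * x)) := by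
  have hs : ∀ x ∈ Ioi (0 : ℝ), 0 < sinh (a * x) := fun x hx =>
    sinh_pos_iff.2 (mul_pos ha hx)
  have hlin : ∀ x : ℝ, HasDerivAt (fun x => a * x) a x := fun x => by
    simpa using (hasDerivAt_id x).const_mul a
  have hd : ∀ x ∈ Ioi (0 : ℝ), HasDerivAt (fun x => log x - log (sinh (a * x)))
      (x⁻¹ - cosh (a * x) * a / sinh (a * x)) x := fun x hx =>
    (hasDerivAt_log (ne_of_gt hx)).sub ((hlin x).sinh.log (hs x hx).ne')
  refine concaveOn_of_hasDerivWithinAt2_nonpos (convex_Ioi 0)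
    (f' := fun x => x⁻¹ - cosh (a * x) * a / sinh (a * x))
    (f'' := fun x => -(x ^ 2)⁻¹ - (sinh (a * x) * a * a * sinh (a * x) -
      cosh (a * x) * a * (cosh (a * x) * a)) / sinh (a * x) ^ 2)
    (fun x hx => (hd x hx).continuousAt.continuousWithinAt) ?_ ?_ ?_ <;> rw [interior_Ioi]
  · exact fun x hx => (hd x hx).hasDerivWithinAt
  · exact fun x hx => ((hasDerivAt_inv (ne_of_gt hx)).sub
      (((hlin x).cosh.mul_const a).div (hlin x).sinh (hs x hx).ne')).hasDerivWithinAt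
  · intro x hx
    have hx' : 0 < x := hx
    have hle : a * x ≤ sinh (a * x) := self_le_sinh_iff.2 (mul_pos ha hx').le
    have hnum : sinh (a * x) * a * a * sinh (a * x) -
        cosh (a * x) * a * (cosh (a * x) * a) = -a ^ 2 := by
      linear_combination -a ^ 2 * cosh_sq (a * x)
    have hbound : a ^ 2 / sinh (a * x) ^ 2 ≤ (x ^ 2)⁻¹ := by
      rw [inv_eq_one_div, div_le_div_iff₀ (pow_pos (hs x hx) 2) (pow_pos hx' 2), ← mul_pow, one_mul]
      exact pow_le_pow_left₀ (mul_pos ha hx').le hle 2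
    rw [hnum, neg_div]
    linarith


/-- For every `a > 0`, the function `f(x) = x / sinh(a x)` is positive
on `(0, ∞)` and logarithmically concave on `(0, ∞)`:
`f(tx + (1−t)y) ≥ f(x)^t · f(y)^{1−t}` for `x, y > 0` and `t ∈ [0, 1]`. -/
theorem stmt_6 (a : ℝ) (ha : 0 < a) (f : ℝ → ℝ)
    (hf : ∀ x : ℝ, f x = x / Real.sinh (a * x)) :
    (∀ x ∈ Set.Ioi (0:ℝ), 0 < f x) ∧
      (∀ x ∈ Set.Ioi (0:ℝ), ∀ y ∈ Set.Ioi (0:ℝ), ∀ t ∈ Set.Icc (0:ℝ) 1,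
        f (t * x + (1 - t) * y) ≥ f x ^ t * f y ^ (1 - t)) := by
  have hpos : ∀ x ∈ Ioi (0 : ℝ), 0 < f x := fun x hx => by
    rw [hf]
    exact div_pos hx (sinh_pos_iff.2 (mul_pos ha hx))
  have hlog : ∀ x ∈ Ioi (0 : ℝ), log (f x) = log x - log (sinh (a * x)) := fun x hx => by
    rw [hf, log_div (ne_of_gt hx) (sinh_pos_iff.2 (mul_pos ha hx)).ne']
  refine ⟨hpos, fun x hx y hy t ht => ?_⟩
  have ht' : 0 ≤ 1 - t := sub_nonneg.2 ht.2
  have hz : t * x + (1 - t) * y ∈ Ioi (0 : ℝ) :=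
    convex_Ioi (0 : ℝ) hx hy ht.1 ht' (add_sub_cancel t 1)
  have hconc := (concaveOn_log_sub_log_sinh_mul ha).2 hx hy ht.1 ht' (add_sub_cancel t 1)
  simp only [smul_eq_mul] at hconc
  rw [← hlog x hx, ← hlog y hy, ← hlog _ hz] at hconc
  rw [ge_iff_le, ← log_le_log_iff
    (mul_pos (rpow_pos_of_pos (hpos x hx) t) (rpow_pos_of_pos (hpos y hy) (1 - t))) (hpos _ hz),
    log_mul (rpow_pos_of_pos (hpos x hx) t).ne' (rpow_pos_of_pos (hpos y hy) (1 - t)).ne',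
    log_rpow (hpos x hx), log_rpow (hpos y hy)]
  exact hconc
end

section
/- Let H be a real inner product space and L : H → H a linear map that is symmetric (⟨Lu, v⟩ = ⟨u, Lv⟩ for all u, v ∈ H). Suppose there are χ, d ∈ H and λ₀ ≠ 0 with ‖χ‖ = 1, Lχ = −λ₀²χ, d ≠ 0, Ld = 0, and a constant c₁ > 0 such that ⟨Lp, p⟩ ≥ c₁‖p‖² for every p ∈ H orthogonal to both χ and d. Let ψ₁, e ∈ H and set Υ₀ = {u ∈ H : ⟨ψ₁, u⟩ = 0 and ⟨e, u⟩ = 0}. If there exists Φ ∈ H with ⟨LΦ, φ⟩ = 0 for all φ ∈ Υ₀ and ⟨LΦ, Φ⟩ < 0, then there exists a constant c > 0 such that ⟨Lv, v⟩ ≥ c‖v‖² for all v ∈ Υ₀ with ⟨v, d⟩ = 0. -/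
open RealInnerProductSpace

/-- The Cauchy-Schwarz inequality for the quadratic form of a symmetric operator that is
nonnegative on a subspace. -/
lemma inner_map_sq_le_of_nonneg_on {H : Type*} [NormedAddCommGroup H] [InnerProductSpace ℝ H]
    (L : H →ₗ[ℝ] H) (hsym : ∀ u v : H, ⟪L u, v⟫ = ⟪u, L v⟫) (S : Submodule ℝ H)
    (hS : ∀ p ∈ S, 0 ≤ ⟪L p, p⟫) {p q : H} (hp : p ∈ S) (hq : q ∈ S) :
    ⟪L q, p⟫ ^ 2 ≤ ⟪L q, q⟫ * ⟪L p, p⟫ := by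
  have hpq : ⟪L p, q⟫ = ⟪L q, p⟫ := by rw [hsym, real_inner_comm]
  have hdisc : discrim ⟪L p, p⟫ (2 * ⟪L q, p⟫) ⟪L q, q⟫ ≤ 0 := by
    refine discrim_le_zero fun t => ?_
    have h := hS (t • p + q) (S.add_mem (S.smul_mem t hp) hq)
    simp only [map_add, map_smul, inner_add_left, inner_add_right, real_inner_smul_left,
      real_inner_smul_right, hpq] at h
    linarith
  rw [discrim] at hdisc
  linarith

/-- Abstract coercivity proposition: if the symmetric operator `L` has
a simple negative direction `χ` (eigenvalue `−lam₀²`), kernel direction `d`, is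
coercive on the orthogonal complement of `{χ, d}`, and there is `Φ` with
`⟨LΦ, φ⟩ = 0` for all `φ ∈ Υ₀ = {u : ⟨ψ₁,u⟩ = ⟨e,u⟩ = 0}` and `⟨LΦ, Φ⟩ < 0`,
then `L` is coercive on `{v ∈ Υ₀ : ⟨v, d⟩ = 0}`. -/
theorem stmt_7 {H : Type*} [NormedAddCommGroup H] [InnerProductSpace ℝ H]
    (L : H →ₗ[ℝ] H) (hsym : ∀ u v : H, ⟪L u, v⟫ = ⟪u, L v⟫)
    (χ d : H) (lam₀ : ℝ) (hlam₀ : lam₀ ≠ 0) (hχ : ‖χ‖ = 1)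
    (hLχ : L χ = -(lam₀ ^ 2) • χ)
    (hd : d ≠ 0) (hLd : L d = 0)
    (c₁ : ℝ) (hc₁ : 0 < c₁)
    (hcoer : ∀ p : H, ⟪χ, p⟫ = 0 → ⟪d, p⟫ = 0 → ⟪L p, p⟫ ≥ c₁ * ‖p‖ ^ 2)
    (ψ₁ e : H)
    (Φ : H)
    (hΦorth : ∀ φ : H, ⟪ψ₁, φ⟫ = 0 → ⟪e, φ⟫ = 0 → ⟪L Φ, φ⟫ = 0)
    (hΦneg : ⟪L Φ, Φ⟫ < 0) :
    ∃ c : ℝ, 0 < c ∧ ∀ v : H, ⟪ψ₁, v⟫ = 0 → ⟪e, v⟫ = 0 → ⟪v, d⟫ = 0 →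
      ⟪L v, v⟫ ≥ c * ‖v‖ ^ 2 := by
  have hl : 0 < lam₀ ^ 2 := by positivity
  have hχχ : ⟪χ, χ⟫ = 1 := by rw [real_inner_self_eq_norm_sq, hχ, one_pow]
  have hLχ_inner (x : H) : ⟪L χ, x⟫ = -(lam₀ ^ 2) * ⟪χ, x⟫ := by
    rw [hLχ, real_inner_smul_left]
  have hχd : ⟪χ, d⟫ = 0 := by
    have h := hLχ_inner d
    rw [hsym, hLd, inner_zero_right] at h
    simpa [hl.ne', hlam₀] using h
  have hdd : ⟪d, d⟫ ≠ 0 := inner_self_ne_zero.mpr hd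
  have hLd_inner (x : H) : ⟪L x, d⟫ = 0 := by rw [hsym, hLd, inner_zero_right]
  have hLχ_right (x : H) : ⟪L x, χ⟫ = -(lam₀ ^ 2) * ⟪χ, x⟫ := by
    rw [hsym, real_inner_comm, hLχ_inner]
  let S : Submodule ℝ H := (ℝ ∙ χ)ᗮ ⊓ (ℝ ∙ d)ᗮ
  have mem_S {p : H} : p ∈ S ↔ ⟪χ, p⟫ = 0 ∧ ⟪d, p⟫ = 0 := by
    simp [S, Submodule.mem_orthogonal_singleton_iff_inner_right]
  have hS (p : H) (hp : p ∈ S) : 0 ≤ ⟪L p, p⟫ :=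
    le_trans (by positivity) (hcoer p (mem_S.mp hp).1 (mem_S.mp hp).2)
  obtain ⟨b, f, q, hq, rfl⟩ : ∃ b f : ℝ, ∃ q ∈ S, Φ = b • χ + f • d + q := by
    refine ⟨⟪χ, Φ⟫, ⟪d, Φ⟫ / ⟪d, d⟫, Φ - ⟪χ, Φ⟫ • χ - (⟪d, Φ⟫ / ⟪d, d⟫) • d, mem_S.mpr ?_,
      by abel⟩
    simp only [inner_sub_right, real_inner_smul_right, hχχ, hχd, real_inner_comm χ d]
    exact ⟨by ring, by field_simp; ring⟩
  have hq' := mem_S.mp hq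
  have hΦq : ⟪L q, q⟫ < lam₀ ^ 2 * b ^ 2 := by
    simp only [map_add, map_smul, inner_add_left, inner_add_right, real_inner_smul_left,
      real_inner_smul_right, hLd, hLd_inner, hLχ_inner, hLχ_right, hχχ, hq'.1,
      inner_zero_left] at hΦneg
    linarith
  have hQ : 0 ≤ ⟪L q, q⟫ := hS q hq
  have hlb : 0 < lam₀ ^ 2 * b ^ 2 := hQ.trans_lt hΦq
  set θ : ℝ := ⟪L q, q⟫ / (lam₀ ^ 2 * b ^ 2) with hθ
  have hθ0 : 0 ≤ θ := by positivity
  have hθ1 : θ < 1 := (div_lt_one hlb).mpr hΦq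
  have hK : 0 < θ / lam₀ ^ 2 + 1 / c₁ := by positivity
  refine ⟨(1 - θ) / (θ / lam₀ ^ 2 + 1 / c₁), div_pos (sub_pos.mpr hθ1) hK,
    fun v hψv hev hvd => ?_⟩
  obtain ⟨a, p, hp, rfl⟩ : ∃ a : ℝ, ∃ p ∈ S, v = a • χ + p := by
    refine ⟨⟪χ, v⟫, v - ⟪χ, v⟫ • χ, mem_S.mpr ?_, by abel⟩
    simp only [inner_sub_right, real_inner_smul_right, hχχ, real_inner_comm χ d, hχd,
      real_inner_comm v d, hvd]
    simp
  have hp' := mem_S.mp hp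
  have hcross : ⟪L q, p⟫ = lam₀ ^ 2 * (a * b) := by
    have h := hΦorth _ hψv hev
    simp only [map_add, map_smul, inner_add_left, inner_add_right, real_inner_smul_left,
      real_inner_smul_right, hLd, hLχ_inner, hLχ_right, hχχ, hp'.1, hq'.1,
      inner_zero_left] at h
    linarith
  have hLv : ⟪L (a • χ + p), a • χ + p⟫ = ⟪L p, p⟫ - lam₀ ^ 2 * a ^ 2 := by
    simp only [map_add, map_smul, inner_add_left, inner_add_right, real_inner_smul_left,
      real_inner_smul_right, hLχ_inner, hLχ_right, hχχ, hp'.1]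
    ring
  have hnorm : ‖a • χ + p‖ ^ 2 = a ^ 2 + ‖p‖ ^ 2 := by
    rw [norm_add_sq_real, real_inner_smul_left, hp'.1, norm_smul, hχ, mul_one, Real.norm_eq_abs,
      sq_abs]
    ring
  have hcs := inner_map_sq_le_of_nonneg_on L hsym S hS hp hq
  have ha : lam₀ ^ 2 * a ^ 2 ≤ θ * ⟪L p, p⟫ := by
    rw [hθ, div_mul_eq_mul_div, le_div_iff₀ hlb]
    rw [hcross] at hcs
    linarith
  have ha' : a ^ 2 ≤ θ / lam₀ ^ 2 * ⟪L p, p⟫ := by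
    rw [div_mul_eq_mul_div, le_div_iff₀ hl]
    linarith
  have hpc : ‖p‖ ^ 2 ≤ 1 / c₁ * ⟪L p, p⟫ := by
    rw [div_mul_eq_mul_div, one_mul, le_div_iff₀ hc₁, mul_comm]
    exact hcoer p hp'.1 hp'.2
  rw [hLv, hnorm, ge_iff_le, div_mul_eq_mul_div, div_le_iff₀ hK]
  calc (1 - θ) * (a ^ 2 + ‖p‖ ^ 2)
      ≤ (1 - θ) * ((θ / lam₀ ^ 2 + 1 / c₁) * ⟪L p, p⟫) :=
        mul_le_mul_of_nonneg_left (by linarith) (sub_pos.mpr hθ1).le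
    _ = (1 - θ) * ⟪L p, p⟫ * (θ / lam₀ ^ 2 + 1 / c₁) := by ring
    _ ≤ (⟪L p, p⟫ - lam₀ ^ 2 * a ^ 2) * (θ / lam₀ ^ 2 + 1 / c₁) :=
        mul_le_mul_of_nonneg_right (by linarith) hK.le
end

section
/- Let H be a real inner product space and L : H → H a linear map that is symmetric (⟨Lu, v⟩ = ⟨u, Lv⟩ for all u, v ∈ H). Suppose there are χ, d ∈ H and λ₀ ≠ 0 with ‖χ‖ = 1, Lχ = −λ₀²χ, d ≠ 0, Ld = 0, and ⟨Lp, p⟩ ≥ 0 for every p ∈ H orthogonal to both χ and d. Let ψ₁ ∈ H with ⟨ψ₁, d⟩ = 0 and ⟨χ, ψ₁⟩ ≠ 0, and suppose there exists Φ ∈ H with LΦ = ψ₁ and ⟨Φ, ψ₁⟩ ≤ 0. Then ⟨Lφ, φ⟩ ≥ 0 for every φ ∈ H with ⟨φ, ψ₁⟩ = 0. -/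
open RealInnerProductSpace

/-- If the quadratic form of a symmetric operator is nonnegative on `{χ, d}ᗮ`, where `d` is in the
kernel and orthogonal to `χ`, then it is nonnegative on `χᗮ`. -/
lemma inner_map_self_nonneg_of_ker {H : Type*} [NormedAddCommGroup H] [InnerProductSpace ℝ H]
    {L : H →ₗ[ℝ] H} (hsym : ∀ u v : H, ⟪L u, v⟫ = ⟪u, L v⟫) {χ d : H}
    (hd : d ≠ 0) (hLd : L d = 0) (hχd : ⟪χ, d⟫ = 0)
    (hpos : ∀ p : H, ⟪χ, p⟫ = 0 → ⟪d, p⟫ = 0 → 0 ≤ ⟪L p, p⟫)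
    {v : H} (hv : ⟪χ, v⟫ = 0) : 0 ≤ ⟪L v, v⟫ := by
  have hdd : ⟪d, d⟫ ≠ 0 := inner_self_ne_zero.mpr hd
  have h := hpos (v - (⟪d, v⟫ / ⟪d, d⟫) • d)
    (by rw [inner_sub_right, real_inner_smul_right, hv, hχd]; ring)
    (by rw [inner_sub_right, real_inner_smul_right]; field_simp; ring)
  rw [map_sub, map_smul, hLd, smul_zero, sub_zero, inner_sub_right, real_inner_smul_right,
    hsym v d, hLd, inner_zero_right, mul_zero, sub_zero] at h
  exact h

/-- Abstract form of Weinstein's lemma: if the symmetric operator `L`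
has negative direction `χ` (eigenvalue `−lam₀²`), kernel direction `d`, and
nonnegative quadratic form on the orthogonal complement of `{χ, d}`, and if
`ψ₁ ⊥ d`, `⟨χ, ψ₁⟩ ≠ 0`, and `Φ` satisfies `LΦ = ψ₁` with `⟨Φ, ψ₁⟩ ≤ 0`, then
`⟨Lφ, φ⟩ ≥ 0` for every `φ ⊥ ψ₁`. -/
theorem stmt_8 {H : Type*} [NormedAddCommGroup H] [InnerProductSpace ℝ H]
    (L : H →ₗ[ℝ] H) (hsym : ∀ u v : H, ⟪L u, v⟫ = ⟪u, L v⟫)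
    (χ d : H) (lam₀ : ℝ) (hlam₀ : lam₀ ≠ 0) (hχ : ‖χ‖ = 1)
    (hLχ : L χ = -(lam₀ ^ 2) • χ)
    (hd : d ≠ 0) (hLd : L d = 0)
    (hpos : ∀ p : H, ⟪χ, p⟫ = 0 → ⟪d, p⟫ = 0 → ⟪L p, p⟫ ≥ 0)
    (ψ₁ : H) (hψ₁d : ⟪ψ₁, d⟫ = 0) (hχψ₁ : ⟪χ, ψ₁⟫ ≠ 0)
    (Φ : H) (hLΦ : L Φ = ψ₁) (hΦψ₁ : ⟪Φ, ψ₁⟫ ≤ 0) :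
    ∀ φ : H, ⟪φ, ψ₁⟫ = 0 → ⟪L φ, φ⟫ ≥ 0 := by
  intro φ hφ
  have hχd : ⟪χ, d⟫ = 0 := by
    have h := hsym χ d
    rw [hLχ, hLd, real_inner_smul_left, inner_zero_right] at h
    simpa [hlam₀] using h
  have hχΦ : ⟪χ, Φ⟫ ≠ 0 := by
    intro h0
    have h := hsym χ Φ
    rw [hLχ, hLΦ, real_inner_smul_left, h0, mul_zero] at h
    exact hχψ₁ h.symm
  have h := inner_map_self_nonneg_of_ker hsym hd hLd hχd hpos
    (v := ⟪χ, Φ⟫ • φ - ⟪χ, φ⟫ • Φ)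
    (by rw [inner_sub_right, real_inner_smul_right, real_inner_smul_right]; ring)
  have hφΦ : ⟪L φ, Φ⟫ = 0 := by rw [hsym, hLΦ, hφ]
  rw [map_sub, map_smul, map_smul, hLΦ] at h
  simp only [inner_sub_left, inner_sub_right, real_inner_smul_left, real_inner_smul_right, hφΦ,
    real_inner_comm φ ψ₁, real_inner_comm Φ ψ₁, hφ] at h
  have hsq : 0 < ⟪χ, Φ⟫ ^ 2 := by positivity
  refine nonneg_of_mul_nonneg_right (?_ : 0 ≤ ⟪χ, Φ⟫ ^ 2 * ⟪L φ, φ⟫) hsq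
  nlinarith [mul_nonneg (sq_nonneg ⟪χ, φ⟫) (neg_nonneg.mpr hΦψ₁)]
end

section
/- Let L₀ > 0, ω₀, A₀ ∈ ℝ, and let ψ₀ : ℝ → ℝ be a smooth, even, L₀-periodic function solving ψ₀'''' − ψ₀'' + ω₀ψ₀ − (1/2)ψ₀² + A₀ = 0 on ℝ. Assume that the only smooth, even, L₀-periodic function u satisfying the linearized equation u'''' − u'' + ω₀u − ψ₀u = 0 is u ≡ 0. Then there exist an open set O ⊆ ℝ² containing (ω₀, A₀) and a family of functions Ψ(ω, A) : ℝ → ℝ defined for (ω, A) ∈ O such that: Ψ(ω₀, A₀) = ψ₀; for every (ω, A) ∈ O, Ψ(ω, A) is smooth, even, and L₀-periodic and satisfies Ψ(ω,A)'''' − Ψ(ω,A)'' + ωΨ(ω,A) − (1/2)Ψ(ω,A)² + A = 0 on ℝ; and for every k ∈ ℕ, the map (ω, A) ↦ (k-th derivative of Ψ(ω, A)) is continuous from O into the bounded continuous functions on ℝ equipped with the supremum norm. -/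
open Filter Topology

section AbstractBranch

variable {E : Type*} [NormedCommRing E] [NormedAlgebra ℝ E] [CompleteSpace E]

/-- Implicit function theorem for `ψ = K ((1/4 - ω) ψ + ψ² / 2 - A)` with `K` compact, in a
commutative Banach algebra, at a nondegenerate solution. -/
theorem exists_continuousOn_branch_of_isCompactOperator (K : E →L[ℝ] E) (hK : IsCompactOperator K)
    (ω₀ A₀ : ℝ) (ψ₀ : E)
    (h₀ : ψ₀ = K ((1 / 4 - ω₀) • ψ₀ + (1 / 2 : ℝ) • (ψ₀ * ψ₀) - A₀ • (1 : E)))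
    (hker : ∀ u : E, u = K ((1 / 4 - ω₀) • u + ψ₀ * u) → u = 0) :
    ∃ O : Set (ℝ × ℝ), IsOpen O ∧ (ω₀, A₀) ∈ O ∧ ∃ φ : ℝ × ℝ → E, ContinuousOn φ O ∧
      φ (ω₀, A₀) = ψ₀ ∧ ∀ p ∈ O,
        φ p = K ((1 / 4 - p.1) • φ p + (1 / 2 : ℝ) • (φ p * φ p) - p.2 • (1 : E)) := by
  let F : (ℝ × ℝ) × E → E := fun q =>
    q.2 - K ((1 / 4 - q.1.1) • q.2 + (1 / 2 : ℝ) • (q.2 * q.2) - q.1.2 • (1 : E))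
  have hF : ContDiff ℝ 1 F := by
    fun_prop
  let M : E →L[ℝ] E := (1 / 4 - ω₀) • ContinuousLinearMap.id ℝ E + ContinuousLinearMap.mul ℝ E ψ₀
  have hpartial : fderiv ℝ F ((ω₀, A₀), ψ₀) ∘L .inr ℝ (ℝ × ℝ) E =
      ContinuousLinearMap.id ℝ E - K ∘L M := by
    have h1 : HasFDerivAt (fun u : E => F ((ω₀, A₀), u))
        (fderiv ℝ F ((ω₀, A₀), ψ₀) ∘L .inr ℝ (ℝ × ℝ) E) ψ₀ := by
      have hd := ((hF.differentiable one_ne_zero) ((ω₀, A₀), ψ₀)).hasFDerivAt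
      exact hd.comp ψ₀ (hasFDerivAt_prodMk_right (𝕜 := ℝ) (ω₀, A₀) ψ₀)
    have h2 : HasFDerivAt (fun u : E => F ((ω₀, A₀), u))
        (ContinuousLinearMap.id ℝ E - K ∘L M) ψ₀ := by
      have hid := hasFDerivAt_id (𝕜 := ℝ) ψ₀
      have := hid.sub (K.hasFDerivAt.comp ψ₀ (((hid.const_smul (1 / 4 - ω₀)).add
        ((hid.mul hid).const_smul (1 / 2 : ℝ))).sub_const (A₀ • (1 : E))))
      refine this.congr_fderiv ?_
      ext u
      simp only [M, _root_.sub_apply, ContinuousLinearMap.comp_apply,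
        _root_.add_apply, _root_.smul_apply,
        ContinuousLinearMap.id_apply, ContinuousLinearMap.mul_apply', id, smul_eq_mul]
      congr 3
      rw [← two_smul ℝ (ψ₀ * u), smul_smul]
      norm_num
    exact h1.unique h2
  have hunit : IsUnit (ContinuousLinearMap.id ℝ E - K ∘L M) := by
    have hc : IsCompactOperator (K ∘L M) := hK.comp_clm M
    rcases hc.hasEigenvalue_or_mem_resolventSet one_ne_zero with h | h
    · obtain ⟨u, hu⟩ := h.exists_hasEigenvector
      refine absurd (hker u ?_) hu.2
      have := hu.apply_eq_smul
      simpa [M] using this.symm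
    · rw [spectrum.mem_resolventSet_iff, map_one] at h
      exact h
  have hinv : (fderiv ℝ F ((ω₀, A₀), ψ₀) ∘L .inr ℝ (ℝ × ℝ) E).IsInvertible := by
    rw [hpartial]
    obtain ⟨e, he⟩ := hunit
    exact ⟨ContinuousLinearEquiv.unitsEquiv ℝ E e, by ext; simp [← he]⟩
  have hFu : F ((ω₀, A₀), ψ₀) = 0 := by simpa [F, sub_eq_zero] using h₀
  have cdf : ContDiffAt ℝ 1 F ((ω₀, A₀), ψ₀) := hF.contDiffAt
  have hev := (cdf.eventually_apply_implicitFunction one_ne_zero hinv).and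
    (((cdf.contDiffAt_implicitFunction one_ne_zero hinv).eventually (by simp)).mono
      fun _ h => h.continuousAt)
  obtain ⟨O, hO, hOo, hmem⟩ := eventually_nhds_iff.1 hev
  refine ⟨O, hOo, hmem, cdf.implicitFunction one_ne_zero hinv,
    fun p hp => (hO p hp).2.continuousWithinAt,
    cdf.implicitFunction_apply_self one_ne_zero hinv, fun p hp => ?_⟩
  have := (hO p hp).1
  rw [hFu] at this
  exact sub_eq_zero.1 this

end AbstractBranch

section ConvExp

variable {L : ℝ}

open intervalIntegral

/-- The only `L`-periodic solution of `z' = c z` with `c ≠ 0` is zero. -/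
theorem Function.Periodic.eq_zero_of_hasDerivAt_mul {z : ℝ → ℝ} {c : ℝ} (hL : L ≠ 0) (hc : c ≠ 0)
    (hp : Function.Periodic z L) (hz : ∀ x, HasDerivAt z (c * z x) x) (x : ℝ) : z x = 0 := by
  have hd : ∀ y, HasDerivAt (fun y => Real.exp (-(c * y)) * z y) 0 y := fun y => by
    have h1 : HasDerivAt (fun y => Real.exp (-(c * y))) (Real.exp (-(c * y)) * -(c * 1)) y :=
      (((hasDerivAt_id y).const_mul c).neg).exp
    refine (h1.mul (hz y)).congr_deriv ?_
    ring
  have h := is_const_of_deriv_eq_zero (fun y => (hd y).differentiableAt) (fun y => (hd y).deriv)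
    (x + L) x
  simp only [hp x] at h
  rw [← sub_eq_zero, ← sub_mul] at h
  refine (mul_eq_zero.1 h).resolve_left (sub_ne_zero.2 fun he => ?_)
  have := Real.exp_injective he
  exact mul_ne_zero hc hL (by linarith)

variable [hL : Fact (0 < L)]

/-- The periodic solution operator `f ↦ v` of the first order equation `v' + c v = f`, for
`c ≠ 0`. -/
noncomputable def periodicInv (L : ℝ) [Fact (0 < L)] (c : ℝ) :
    C(AddCircle L, ℝ) →L[ℝ] C(AddCircle L, ℝ) :=
  LinearMap.mkContinuous
    { toFun := fun f =>
        { toFun := fun θ => (1 - Real.exp (-(c * L)))⁻¹ *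
            ∫ s in (0 : ℝ)..L, Real.exp (-(c * s)) * f (θ - (s : AddCircle L))
          continuous_toFun := by
            refine continuous_const.mul
              (continuous_parametric_intervalIntegral_of_continuous' ?_ _ _)
            have := AddCircle.continuous_mk' L
            simp only [Function.uncurry_def]
            fun_prop }
      map_add' := fun f g => by
        have hmk := AddCircle.continuous_mk' L
        ext θ
        simp only [ContinuousMap.coe_mk, ContinuousMap.add_apply, mul_add]
        rw [integral_add, mul_add] <;>
          exact Continuous.intervalIntegrable (by fun_prop) _ _
      map_smul' := fun a f => by
        ext θ
        simp only [ContinuousMap.coe_mk, ContinuousMap.smul_apply, smul_eq_mul, RingHom.id_apply]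
        rw [mul_left_comm, ← integral_const_mul a]
        congr 1
        refine integral_congr fun s _ => ?_
        ring }
    (|(1 - Real.exp (-(c * L)))⁻¹| * (Real.exp (|c| * L) * L)) (fun f => by
      have hL0 : (0 : ℝ) < L := Fact.out
      rw [ContinuousMap.norm_le _ (by positivity)]
      intro θ
      simp only [LinearMap.coe_mk, AddHom.coe_mk, ContinuousMap.coe_mk, norm_mul, Real.norm_eq_abs]
      rw [mul_assoc]
      gcongr
      have := norm_integral_le_of_norm_le_const (a := 0) (b := L)
        (f := fun s : ℝ => Real.exp (-(c * s)) * f (θ - (s : AddCircle L)))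
        (C := Real.exp (|c| * L) * ‖f‖) (fun s hs => by
          rw [Set.uIoc_of_le hL0.le] at hs
          rw [norm_mul, Real.norm_eq_abs, Real.abs_exp]
          gcongr
          · calc -(c * s) ≤ |c * s| := neg_le_abs _
              _ = |c| * s := by rw [abs_mul, abs_of_pos hs.1]
              _ ≤ |c| * L := by gcongr; exact hs.2
          · exact f.norm_coe_le_norm _)
      rw [Real.norm_eq_abs, sub_zero, abs_of_pos hL0] at this
      linarith)

theorem periodicInv_apply (c : ℝ) (f : C(AddCircle L, ℝ)) (θ : AddCircle L) :
    periodicInv L c f θ = (1 - Real.exp (-(c * L)))⁻¹ *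
      ∫ s in (0 : ℝ)..L, Real.exp (-(c * s)) * f (θ - (s : AddCircle L)) := rfl

theorem one_sub_exp_ne_zero {c : ℝ} (hc : c ≠ 0) : 1 - Real.exp (-(c * L)) ≠ 0 := by
  have hL0 : (0 : ℝ) < L := Fact.out
  rw [sub_ne_zero, ne_comm, Ne, Real.exp_eq_one_iff, neg_eq_zero]
  exact mul_ne_zero hc hL0.ne'

theorem hasDerivAt_periodicInv {c : ℝ} (hc : c ≠ 0) (f : C(AddCircle L, ℝ)) (x : ℝ) :
    HasDerivAt (fun x : ℝ => periodicInv L c f x) (f x - c * periodicInv L c f x) x := by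
  have hmk := AddCircle.continuous_mk' L
  set C := (1 - Real.exp (-(c * L)))⁻¹ with hC
  let g : ℝ → ℝ := fun t => Real.exp (c * t) * f (t : AddCircle L)
  have hg : Continuous g := by fun_prop
  have hrep : ∀ y : ℝ, periodicInv L c f y =
      C * (Real.exp (-(c * y)) * ((∫ t in (0 : ℝ)..y, g t) - ∫ t in (0 : ℝ)..(y - L), g t)) := by
    intro y
    rw [periodicInv_apply, integral_interval_sub_left (hg.intervalIntegrable _ _)
      (hg.intervalIntegrable _ _), ← integral_const_mul (Real.exp (-(c * y)))]
    have := integral_comp_sub_left (a := 0) (b := L)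
      (fun t => Real.exp (-(c * y)) * g t) y
    rw [sub_zero] at this
    rw [← this]
    congr 2
    ext s
    simp only [g]
    rw [← mul_assoc, ← Real.exp_add]
    congr 2
    ring
  have hG : ∀ y, HasDerivAt (fun y => ∫ t in (0 : ℝ)..y, g t) (g y) y := fun y =>
    hg.integral_hasStrictDerivAt 0 y |>.hasDerivAt
  have h1 : HasDerivAt (fun y => Real.exp (-(c * y))) (Real.exp (-(c * x)) * -(c * 1)) x :=
    (((hasDerivAt_id x).const_mul c).neg).exp
  have h2 := ((h1.mul ((hG x).sub ((hG (x - L)).comp_sub_const x L))).const_mul C)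
  rw [show (fun x : ℝ => periodicInv L c f x) = _ from funext hrep]
  refine h2.congr_deriv ?_
  simp only [hrep]
  have hper : ((x - L : ℝ) : AddCircle L) = x := by
    rw [AddCircle.coe_sub, AddCircle.coe_period, sub_zero]
  simp only [g, hper, Pi.sub_apply]
  have e1 : Real.exp (-(c * x)) * Real.exp (c * x) = 1 := by
    rw [← Real.exp_add]; simp
  have e2 : Real.exp (-(c * x)) * Real.exp (c * (x - L)) = Real.exp (-(c * L)) := by
    rw [← Real.exp_add]; congr 1; ring
  have e3 : C * (1 - Real.exp (-(c * L))) = 1 := inv_mul_cancel₀ (one_sub_exp_ne_zero hc)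
  linear_combination (C * f x) * e1 - (C * f x) * e2 + f x * e3

theorem isCompactOperator_periodicInv {c : ℝ} (hc : c ≠ 0) :
    IsCompactOperator (periodicInv L c) := by
  set T := periodicInv L c with hT
  refine (isCompactOperator_iff_isCompact_closure_image_closedBall
    (T : C(AddCircle L, ℝ) →ₗ[ℝ] C(AddCircle L, ℝ)) one_pos).2 ?_
  let e := ContinuousMap.isometryEquivBoundedOfCompact (AddCircle L) ℝ
  set S := (T : C(AddCircle L, ℝ) →ₗ[ℝ] C(AddCircle L, ℝ)) '' Metric.closedBall 0 1
  have hS : ∀ v ∈ S, ‖v‖ ≤ ‖T‖ ∧ ∀ x y : ℝ, ‖v y - v x‖ ≤ (1 + |c| * ‖T‖) * ‖y - x‖ := by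
    rintro _ ⟨f, hf, rfl⟩
    rw [mem_closedBall_zero_iff] at hf
    have hv : ‖T f‖ ≤ ‖T‖ := (T.le_opNorm f).trans (mul_le_of_le_one_right (norm_nonneg _) hf)
    refine ⟨hv, fun x y => ?_⟩
    refine Convex.norm_image_sub_le_of_norm_hasDerivWithin_le (s := Set.univ)
      (f := fun x : ℝ => T f x)
      (fun z _ => (hasDerivAt_periodicInv hc f z).hasDerivWithinAt) (fun z _ => ?_)
      convex_univ trivial trivial
    refine (norm_sub_le _ _).trans (add_le_add ((f.norm_coe_le_norm _).trans hf) ?_)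
    rw [norm_mul, Real.norm_eq_abs]
    gcongr
    exact ((T f).norm_coe_le_norm _).trans hv
  have hcomp : IsCompact (closure (e '' S)) := by
    refine BoundedContinuousFunction.arzela_ascoli (Metric.closedBall (0 : ℝ) ‖T‖)
      (isCompact_closedBall _ _) _ ?_ ?_
    · rintro _ θ ⟨v, hv, rfl⟩
      rw [mem_closedBall_zero_iff]
      exact (v.norm_coe_le_norm θ).trans (hS v hv).1
    · intro θ
      induction θ using QuotientAddGroup.induction_on with | H x =>
      rw [Metric.equicontinuousAt_iff_right]
      intro ε hε
      have hnhds : 𝓝 (x : AddCircle L) = map ((↑) : ℝ → AddCircle L) (𝓝 x) :=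
        (QuotientAddGroup.isOpenMap_coe.map_nhds_eq
          (AddCircle.continuous_mk' L).continuousAt).symm
      change ∀ᶠ z in 𝓝 (x : AddCircle L), _
      rw [hnhds, eventually_map]
      have hlim : Tendsto (fun y : ℝ => (1 + |c| * ‖T‖) * ‖y - x‖) (𝓝 x) (𝓝 0) := by
        have : Continuous (fun y : ℝ => (1 + |c| * ‖T‖) * ‖y - x‖) := by fun_prop
        simpa using this.tendsto x
      filter_upwards [hlim.eventually_lt_const hε] with y hy
      rintro ⟨_, v, hv, rfl⟩
      rw [dist_comm, dist_eq_norm]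
      exact ((hS v hv).2 x y).trans_lt hy
  rw [← e.toHomeomorph.isCompact_image, e.toHomeomorph.image_closure]
  exact hcomp

end ConvExp

section Resolvent

variable {L : ℝ} [hL : Fact (0 < L)]

/-- The inverse of `m² - d²/dx²` on continuous periodic functions. -/
noncomputable def periodicResolvent (L : ℝ) [Fact (0 < L)] (m : ℝ) :
    C(AddCircle L, ℝ) →L[ℝ] C(AddCircle L, ℝ) :=
  (2 * m)⁻¹ • (periodicInv L m - periodicInv L (-m))

theorem periodicResolvent_apply (m : ℝ) (f : C(AddCircle L, ℝ)) (θ : AddCircle L) :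
    periodicResolvent L m f θ = (2 * m)⁻¹ * (periodicInv L m f θ - periodicInv L (-m) f θ) := rfl

theorem isCompactOperator_periodicResolvent {m : ℝ} (hm : m ≠ 0) :
    IsCompactOperator (periodicResolvent L m) :=
  ((isCompactOperator_periodicInv hm).sub
    (isCompactOperator_periodicInv (neg_ne_zero.2 hm))).smul (2 * m)⁻¹

theorem hasDerivAt_periodicResolvent {m : ℝ} (hm : m ≠ 0) (f : C(AddCircle L, ℝ)) (x : ℝ) :
    HasDerivAt (fun x : ℝ => periodicResolvent L m f x)
      (-(1 / 2) * (periodicInv L m f x + periodicInv L (-m) f x)) x := by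
  refine (((hasDerivAt_periodicInv hm f x).sub
    (hasDerivAt_periodicInv (neg_ne_zero.2 hm) f x)).const_mul (2 * m)⁻¹).congr_deriv ?_
  field_simp
  ring

theorem hasDerivAt_deriv_periodicResolvent {m : ℝ} (hm : m ≠ 0) (f : C(AddCircle L, ℝ)) (x : ℝ) :
    HasDerivAt (fun x : ℝ => -(1 / 2) * (periodicInv L m f x + periodicInv L (-m) f x))
      (m ^ 2 * periodicResolvent L m f x - f x) x := by
  refine (((hasDerivAt_periodicInv hm f x).add
    (hasDerivAt_periodicInv (neg_ne_zero.2 hm) f x)).const_mul (-(1 / 2))).congr_deriv ?_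
  rw [periodicResolvent_apply]
  field_simp
  ring

theorem iteratedDeriv_two_periodicResolvent {m : ℝ} (hm : m ≠ 0) (f : C(AddCircle L, ℝ)) :
    iteratedDeriv 2 (fun x : ℝ => periodicResolvent L m f x) =
      fun x : ℝ => (m ^ 2 • periodicResolvent L m f - f) x := by
  rw [iteratedDeriv_succ, iteratedDeriv_one,
    funext fun x => (hasDerivAt_periodicResolvent hm f x).deriv,
    funext fun x => (hasDerivAt_deriv_periodicResolvent hm f x).deriv]
  rfl

theorem iteratedDeriv_four_periodicResolvent {m : ℝ} (hm : m ≠ 0) (f : C(AddCircle L, ℝ)) :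
    iteratedDeriv 4 (fun x : ℝ => periodicResolvent L m (periodicResolvent L m f) x) =
      fun x : ℝ => (m ^ 2 • (m ^ 2 • periodicResolvent L m (periodicResolvent L m f) -
        periodicResolvent L m f) - (m ^ 2 • periodicResolvent L m f - f)) x := by
  rw [iteratedDeriv_eq_iterate, show 4 = 2 + 2 from rfl, Function.iterate_add_apply,
    ← iteratedDeriv_eq_iterate, ← iteratedDeriv_eq_iterate, iteratedDeriv_two_periodicResolvent hm,
    ← map_smul, ← map_sub, iteratedDeriv_two_periodicResolvent hm, map_sub, map_smul]

/-- A `C²` periodic solution of `m² g - g'' = f` is given by the resolvent. -/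
theorem periodicResolvent_eq {m : ℝ} (hm : m ≠ 0) {f g : C(AddCircle L, ℝ)}
    (hg : ContDiff ℝ 2 (fun x : ℝ => g x))
    (h : ∀ x : ℝ, iteratedDeriv 2 (fun x : ℝ => g x) x = m ^ 2 * g x - f x) :
    periodicResolvent L m f = g := by
  have hL0 : L ≠ 0 := (Fact.out : 0 < L).ne'
  let w : ℝ → ℝ := fun x => periodicResolvent L m f x - g x
  let w' : ℝ → ℝ := fun x => -(1 / 2) * (periodicInv L m f x + periodicInv L (-m) f x) -
    deriv (fun x : ℝ => g x) x
  have hw : ∀ x, HasDerivAt w (w' x) x := fun x =>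
    (hasDerivAt_periodicResolvent hm f x).sub
      ((hg.differentiable (by simp)) x).hasDerivAt
  have hw' : ∀ x, HasDerivAt w' (m ^ 2 * w x) x := fun x => by
    have hg' : HasDerivAt (deriv fun x : ℝ => g x) (m ^ 2 * g x - f x) x := by
      rw [← h x, iteratedDeriv_succ, iteratedDeriv_one]
      exact ((hg.deriv' (n := 1)).differentiable one_ne_zero x).hasDerivAt
    refine ((hasDerivAt_deriv_periodicResolvent hm f x).sub hg').congr_deriv ?_
    simp only [w]
    ring
  have hper : ∀ φ : AddCircle L → ℝ, Function.Periodic (fun x : ℝ => φ x) L := fun φ x => by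
    simp
  have hpw : Function.Periodic w L :=
    hper fun θ => periodicResolvent L m f θ - g θ
  have hpw' : Function.Periodic w' L := fun x => by
    rw [← (hw x).deriv, ← (hw (x + L)).deriv, ← deriv_comp_add_const]
    exact congrArg (fun q => deriv q x) (funext hpw)
  have hz : ∀ x, w' x + m * w x = 0 :=
    Function.Periodic.eq_zero_of_hasDerivAt_mul (z := fun x => w' x + m * w x) (c := m) hL0 hm
      (fun x => by simp only [hpw x, hpw' x])
      (fun x => ((hw' x).add ((hw x).const_mul m)).congr_deriv (by ring))
  have hw0 : ∀ x, w x = 0 :=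
    Function.Periodic.eq_zero_of_hasDerivAt_mul (c := -m) hL0 (neg_ne_zero.2 hm) hpw
      (fun x => (hw x).congr_deriv (by linarith [hz x]))
  ext θ
  induction θ using QuotientAddGroup.induction_on with | H x =>
  exact sub_eq_zero.1 (hw0 x)

theorem periodicInv_neg_of_even (c : ℝ) {f : C(AddCircle L, ℝ)} (hc : c ≠ 0)
    (hf : ∀ θ, f (-θ) = f θ) (θ : AddCircle L) :
    periodicInv L (-c) f (-θ) = -periodicInv L c f θ := by
  have hsub := intervalIntegral.integral_comp_sub_left (a := 0) (b := L)
    (fun s : ℝ => Real.exp (-(-c * s)) * f (-θ - (s : AddCircle L))) L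
  rw [sub_self, sub_zero] at hsub
  have hint : ∀ s : ℝ, Real.exp (-(-c * (L - s))) * f (-θ - ((L - s : ℝ) : AddCircle L)) =
      Real.exp (c * L) * (Real.exp (-(c * s)) * f (θ - (s : AddCircle L))) := fun s => by
    rw [AddCircle.coe_sub, AddCircle.coe_period, ← hf (θ - s), ← mul_assoc, ← Real.exp_add]
    congr 2
    · ring
    · abel
  simp only [hint, intervalIntegral.integral_const_mul] at hsub
  rw [periodicInv_apply, periodicInv_apply, ← hsub]
  have h1 := one_sub_exp_ne_zero (L := L) hc
  have h2 := one_sub_exp_ne_zero (L := L) (neg_ne_zero.2 hc)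
  have h3 : Real.exp (c * L) * Real.exp (-(c * L)) = 1 := by rw [← Real.exp_add]; simp
  rw [neg_mul, neg_neg] at h2 ⊢
  field_simp
  linear_combination -(∫ s in (0 : ℝ)..L, Real.exp (-(c * s)) * f (θ - (s : AddCircle L))) * h3

theorem periodicResolvent_neg_of_even {m : ℝ} (hm : m ≠ 0) {f : C(AddCircle L, ℝ)}
    (hf : ∀ θ, f (-θ) = f θ) (θ : AddCircle L) :
    periodicResolvent L m f (-θ) = periodicResolvent L m f θ := by
  have h1 := periodicInv_neg_of_even m hm hf θ
  have h2 := periodicInv_neg_of_even m hm hf (-θ)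
  rw [neg_neg] at h2
  rw [periodicResolvent_apply, periodicResolvent_apply, h1, h2]
  ring

/-- The projection of continuous functions on the circle onto even functions. -/
noncomputable def evenPart (L : ℝ) [Fact (0 < L)] : C(AddCircle L, ℝ) →L[ℝ] C(AddCircle L, ℝ) :=
  (1 / 2 : ℝ) • (ContinuousLinearMap.id ℝ _ + LinearMap.mkContinuous
    { toFun := fun f => f.comp ⟨fun θ => -θ, continuous_neg⟩
      map_add' := fun _ _ => rfl
      map_smul' := fun _ _ => rfl } 1 (fun f => by
        rw [ContinuousMap.norm_le _ (by positivity), one_mul]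
        exact fun θ => f.norm_coe_le_norm _))

theorem evenPart_apply (f : C(AddCircle L, ℝ)) (θ : AddCircle L) :
    evenPart L f θ = 1 / 2 * (f θ + f (-θ)) := rfl

theorem evenPart_neg (f : C(AddCircle L, ℝ)) (θ : AddCircle L) :
    evenPart L f (-θ) = evenPart L f θ := by
  rw [evenPart_apply, evenPart_apply, neg_neg, add_comm]

theorem evenPart_eq_self {f : C(AddCircle L, ℝ)} (hf : ∀ θ, f (-θ) = f θ) : evenPart L f = f := by
  ext θ
  rw [evenPart_apply, hf]
  ring

end Resolvent

section Families

variable {L : ℝ} {P : Type*} [TopologicalSpace P]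

/-- A family of functions on the circle, whose first `n` derivatives exist and depend
continuously in the supremum norm on the parameter in `O`. -/
def IsContDiffFamily (O : Set P) : ℕ → (P → C(AddCircle L, ℝ)) → Prop
  | 0, F => ContinuousOn F O
  | n + 1, F => ContinuousOn F O ∧ ∃ F' : P → C(AddCircle L, ℝ), IsContDiffFamily O n F' ∧
      ∀ p ∈ O, ∀ x : ℝ, HasDerivAt (fun y : ℝ => F p y) (F' p x) x

namespace IsContDiffFamily

variable {O : Set P} {n : ℕ} {F G : P → C(AddCircle L, ℝ)}

theorem continuousOn (h : IsContDiffFamily O n F) : ContinuousOn F O := by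
  cases n with
  | zero => exact h
  | succ n => exact h.1

theorem of_succ (h : IsContDiffFamily O (n + 1) F) : IsContDiffFamily O n F := by
  induction n generalizing F with
  | zero => exact h.1
  | succ n ih =>
    obtain ⟨hc, F', hF', hd⟩ := h
    exact ⟨hc, F', ih hF', hd⟩

theorem congr (h : IsContDiffFamily O n F) (hFG : Set.EqOn G F O) : IsContDiffFamily O n G := by
  cases n with
  | zero => exact ContinuousOn.congr h hFG
  | succ n =>
    obtain ⟨hc, F', hF', hd⟩ := h
    exact ⟨hc.congr hFG, F', hF', fun p hp x => by rw [hFG hp]; exact hd p hp x⟩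

theorem add (hF : IsContDiffFamily O n F) (hG : IsContDiffFamily O n G) :
    IsContDiffFamily O n (fun p => F p + G p) := by
  induction n generalizing F G with
  | zero => exact ContinuousOn.add hF hG
  | succ n ih =>
    obtain ⟨hc, F', hF', hd⟩ := hF
    obtain ⟨hc₂, G', hG', hd₂⟩ := hG
    exact ⟨hc.add hc₂, _, ih hF' hG', fun p hp x => (hd p hp x).add (hd₂ p hp x)⟩

theorem mul (hF : IsContDiffFamily O n F) (hG : IsContDiffFamily O n G) :
    IsContDiffFamily O n (fun p => F p * G p) := by
  induction n generalizing F G with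
  | zero => exact ContinuousOn.mul hF hG
  | succ n ih =>
    have hF₀ := hF.of_succ
    have hG₀ := hG.of_succ
    obtain ⟨hc, F', hF', hd⟩ := hF
    obtain ⟨hc₂, G', hG', hd₂⟩ := hG
    exact ⟨hc.mul hc₂, _, (ih hF' hG₀).add (ih hF₀ hG'),
      fun p hp x => (hd p hp x).mul (hd₂ p hp x)⟩

theorem smul_one {c : P → ℝ} (hc : ContinuousOn c O) :
    IsContDiffFamily O n (fun p => c p • (1 : C(AddCircle L, ℝ))) := by
  induction n generalizing c with
  | zero => exact hc.smul continuousOn_const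
  | succ n ih =>
    exact ⟨hc.smul continuousOn_const, _, ih (c := fun _ => 0) continuousOn_const,
      fun p _ x => by simpa using hasDerivAt_const x (c p)⟩

theorem smul (hF : IsContDiffFamily O n F) {c : P → ℝ} (hc : ContinuousOn c O) :
    IsContDiffFamily O n (fun p => c p • F p) :=
  ((smul_one hc).mul hF).congr fun p _ => by simp

theorem sub (hF : IsContDiffFamily O n F) (hG : IsContDiffFamily O n G) :
    IsContDiffFamily O n (fun p => F p - G p) :=
  (hF.add (hG.smul (c := fun _ => -1) continuousOn_const)).congr fun p _ => by
    simp [sub_eq_add_neg]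

theorem periodicInv [Fact (0 < L)] (hF : IsContDiffFamily O n F) {c : ℝ} (hc : c ≠ 0) :
    IsContDiffFamily O (n + 1) (fun p => periodicInv L c (F p)) := by
  induction n generalizing F with
  | zero =>
    have h : ContinuousOn (fun p => _root_.periodicInv L c (F p)) O :=
      (_root_.periodicInv L c).continuous.comp_continuousOn hF.continuousOn
    exact ⟨h, fun p => F p - c • _root_.periodicInv L c (F p), ContinuousOn.sub hF (h.const_smul c),
      fun p _ x => hasDerivAt_periodicInv hc (F p) x⟩
  | succ n ih =>
    exact ⟨(_root_.periodicInv L c).continuous.comp_continuousOn hF.continuousOn,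
      fun p => F p - c • _root_.periodicInv L c (F p),
      hF.sub ((ih hF.of_succ).smul (c := fun _ => c) continuousOn_const),
      fun p _ x => hasDerivAt_periodicInv hc (F p) x⟩

theorem periodicResolvent [Fact (0 < L)] (hF : IsContDiffFamily O n F) {m : ℝ} (hm : m ≠ 0) :
    IsContDiffFamily O (n + 1) (fun p => periodicResolvent L m (F p)) :=
  ((hF.periodicInv hm).sub (hF.periodicInv (neg_ne_zero.2 hm))).smul
    (c := fun _ => (2 * m)⁻¹) continuousOn_const

theorem contDiff (h : IsContDiffFamily O n F) {p : P} (hp : p ∈ O) :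
    ContDiff ℝ n (fun x : ℝ => F p x) := by
  induction n generalizing F with
  | zero =>
    exact contDiff_zero.2 ((F p).continuous.comp (AddCircle.continuous_mk' L))
  | succ n ih =>
    obtain ⟨_, F', hF', hd⟩ := h
    push_cast
    rw [contDiff_succ_iff_deriv]
    refine ⟨fun x => (hd p hp x).differentiableAt, by simp, ?_⟩
    rw [funext fun x => (hd p hp x).deriv]
    exact ih hF'

theorem exists_iteratedDeriv (h : IsContDiffFamily O n F) :
    ∃ D : P → C(AddCircle L, ℝ), ContinuousOn D O ∧
      ∀ p ∈ O, ∀ x : ℝ, D p x = iteratedDeriv n (fun x : ℝ => F p x) x := by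
  induction n generalizing F with
  | zero => exact ⟨F, h, fun p _ x => by simp⟩
  | succ n ih =>
    obtain ⟨_, F', hF', hd⟩ := h
    obtain ⟨D, hD, hDe⟩ := ih hF'
    refine ⟨D, hD, fun p hp x => ?_⟩
    rw [hDe p hp x, iteratedDeriv_succ', funext fun x => (hd p hp x).deriv]

/-- Bootstrapping: a family fixed by a smoothing operation is smooth. -/
theorem of_eq_periodicResolvent [Fact (0 < L)] {m : ℝ} (hm : m ≠ 0) (hF : ContinuousOn F O)
    (hFG : ∀ n, IsContDiffFamily O n F → IsContDiffFamily O n G)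
    (h : ∀ p ∈ O, F p = _root_.periodicResolvent L m (_root_.periodicResolvent L m (G p))) (n : ℕ) :
    IsContDiffFamily O n F := by
  induction n with
  | zero => exact hF
  | succ n ih => exact (((hFG n ih).periodicResolvent hm).periodicResolvent hm).of_succ.congr h

end IsContDiffFamily

end Families

section Kawahara

variable {L : ℝ}

theorem Function.Periodic.exists_continuousMap_addCircle {g : ℝ → ℝ} (hp : Function.Periodic g L)
    (hg : Continuous g) : ∃ f : C(AddCircle L, ℝ), ∀ x : ℝ, f x = g x :=
  ⟨⟨hp.lift, hg.quotient_lift _⟩, fun x => hp.lift_coe x⟩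

theorem fourth_order_eq_of_eq_periodicResolvent [Fact (0 < L)] {m : ℝ} (hm : m ≠ 0)
    (hm2 : m ^ 2 = 1 / 2) {φ h : C(AddCircle L, ℝ)}
    (hφ : φ = periodicResolvent L m (periodicResolvent L m h)) (x : ℝ) :
    iteratedDeriv 4 (fun x : ℝ => φ x) x - iteratedDeriv 2 (fun x : ℝ => φ x) x + 1 / 4 * φ x =
      h x := by
  rw [hφ, iteratedDeriv_four_periodicResolvent hm, iteratedDeriv_two_periodicResolvent hm, hm2]
  simp only [ContinuousMap.sub_apply, ContinuousMap.smul_apply, smul_eq_mul]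
  ring

theorem eq_periodicResolvent_of_fourth_order_eq [Fact (0 < L)] {m : ℝ} (hm : m ≠ 0)
    (hm2 : m ^ 2 = 1 / 2) {φ h : C(AddCircle L, ℝ)}
    (hφ : ContDiff ℝ 4 (fun x : ℝ => φ x))
    (heq : ∀ x : ℝ, iteratedDeriv 4 (fun x : ℝ => φ x) x - iteratedDeriv 2 (fun x : ℝ => φ x) x +
      1 / 4 * φ x = h x) :
    φ = periodicResolvent L m (periodicResolvent L m h) := by
  have h2 : ContDiff ℝ 2 (iteratedDeriv 2 fun x : ℝ => φ x) := by
    rw [iteratedDeriv_eq_iterate]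
    exact ContDiff.iterate_deriv' 2 2 hφ
  have hper : Function.Periodic (fun x : ℝ => φ x) L := fun x => by simp
  have hper2 : Function.Periodic (iteratedDeriv 2 fun x : ℝ => φ x) L := fun x => by
    have := congrFun (iteratedDeriv_comp_add_const 2 (fun x : ℝ => φ x) L) x
    rw [← this]
    exact congrArg (fun q => iteratedDeriv 2 q x) (funext hper)
  obtain ⟨q, hq⟩ := hper2.exists_continuousMap_addCircle h2.continuous
  have hφq : periodicResolvent L m ((1 / 2 : ℝ) • φ - q) = φ :=
    periodicResolvent_eq hm (hφ.of_le (by norm_num)) fun x => by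
      simp [hq, hm2]
  have hqh : periodicResolvent L m h = (1 / 2 : ℝ) • φ - q := by
    have hfun : (fun x : ℝ => ((1 / 2 : ℝ) • φ - q) x) =
        (fun x : ℝ => (1 / 2 : ℝ) * φ x) - iteratedDeriv 2 (fun x : ℝ => φ x) := by
      ext x
      simp [hq]
    have hφ2 : ContDiff ℝ 2 (fun x : ℝ => φ x) := hφ.of_le (by norm_num)
    refine periodicResolvent_eq hm ?_ fun x => ?_
    · rw [hfun]
      exact (contDiff_const.mul hφ2).sub h2
    · rw [hfun, iteratedDeriv_sub (contDiff_const.mul hφ2).contDiffAt h2.contDiffAt,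
        iteratedDeriv_const_mul_field]
      have h4 : iteratedDeriv 2 (iteratedDeriv 2 fun x : ℝ => φ x) x =
          iteratedDeriv 4 (fun x : ℝ => φ x) x := by
        simp only [iteratedDeriv_eq_iterate, ← Function.iterate_add_apply]
      rw [h4, hm2, ← heq x]
      simp only [ContinuousMap.sub_apply, ContinuousMap.smul_apply, smul_eq_mul, hq]
      ring
  rw [hqh, hφq]

/-- Composition with the covering map, from functions on the circle to bounded functions on the
line. -/
noncomputable def circleToBounded [Fact (0 < L)] (f : C(AddCircle L, ℝ)) :
    BoundedContinuousFunction ℝ ℝ :=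
  (BoundedContinuousFunction.mkOfCompact f).compContinuous ⟨_, AddCircle.continuous_mk' L⟩

theorem continuous_circleToBounded [Fact (0 < L)] :
    Continuous (circleToBounded : C(AddCircle L, ℝ) → BoundedContinuousFunction ℝ ℝ) :=
  (BoundedContinuousFunction.continuous_compContinuous _).comp
    (ContinuousMap.isometryEquivBoundedOfCompact (AddCircle L) ℝ).continuous

end Kawahara

/-- Existence of a smooth surface of even periodic traveling waves of
fixed period for the Kawahara traveling-wave equation
`ψ'''' − ψ'' + ωψ − (1/2)ψ² + A = 0`, depending continuously (together with all
derivatives, in the supremum norm) on the parameters `(ω, A)` near `(ω₀, A₀)`,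
provided the linearized operator is injective on smooth even periodic functions. -/
theorem stmt_15 (L₀ ω₀ A₀ : ℝ) (hL₀ : 0 < L₀) (ψ₀ : ℝ → ℝ)
    (hψ₀s : ContDiff ℝ (⊤ : ℕ∞) ψ₀) (hψ₀e : ∀ x : ℝ, ψ₀ (-x) = ψ₀ x)
    (hψ₀p : Function.Periodic ψ₀ L₀)
    (heq : ∀ x : ℝ,
      iteratedDeriv 4 ψ₀ x - iteratedDeriv 2 ψ₀ x + ω₀ * ψ₀ x -
        (1 / 2) * (ψ₀ x) ^ 2 + A₀ = 0)
    (hker : ∀ u : ℝ → ℝ, ContDiff ℝ (⊤ : ℕ∞) u → (∀ x : ℝ, u (-x) = u x) →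
      Function.Periodic u L₀ →
      (∀ x : ℝ,
        iteratedDeriv 4 u x - iteratedDeriv 2 u x + ω₀ * u x - ψ₀ x * u x = 0) →
      ∀ x : ℝ, u x = 0) :
    ∃ O : Set (ℝ × ℝ), IsOpen O ∧ (ω₀, A₀) ∈ O ∧
      ∃ Ψ : ℝ × ℝ → ℝ → ℝ,
        Ψ (ω₀, A₀) = ψ₀ ∧
        (∀ p ∈ O, ContDiff ℝ (⊤ : ℕ∞) (Ψ p) ∧ (∀ x : ℝ, Ψ p (-x) = Ψ p x) ∧
          Function.Periodic (Ψ p) L₀ ∧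
          ∀ x : ℝ,
            iteratedDeriv 4 (Ψ p) x - iteratedDeriv 2 (Ψ p) x + p.1 * Ψ p x -
              (1 / 2) * (Ψ p x) ^ 2 + p.2 = 0) ∧
        ∀ k : ℕ, ∃ D : ℝ × ℝ → BoundedContinuousFunction ℝ ℝ,
          (∀ p ∈ O, ∀ x : ℝ, D p x = iteratedDeriv k (Ψ p) x) ∧
          ContinuousOn D O := by
  have : Fact (0 < L₀) := ⟨hL₀⟩
  obtain ⟨m, hm, hm2⟩ : ∃ m : ℝ, m ≠ 0 ∧ m ^ 2 = 1 / 2 :=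
    ⟨√(1 / 2), by positivity, Real.sq_sqrt (by norm_num)⟩
  set R := periodicResolvent L₀ m with hR
  let K : C(AddCircle L₀, ℝ) →L[ℝ] C(AddCircle L₀, ℝ) := R ∘L R ∘L evenPart L₀
  have hK : IsCompactOperator K :=
    (isCompactOperator_periodicResolvent hm).comp_clm (R ∘L evenPart L₀)
  have hKeven : ∀ f θ, K f (-θ) = K f θ := fun f =>
    periodicResolvent_neg_of_even hm (periodicResolvent_neg_of_even hm (evenPart_neg f))
  have hKR : ∀ f : C(AddCircle L₀, ℝ), (∀ θ, f (-θ) = f θ) → K f = R (R f) := fun f hf => by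
    simp only [K, ContinuousLinearMap.comp_apply, evenPart_eq_self hf]
  obtain ⟨φ₀, hφ₀⟩ := hψ₀p.exists_continuousMap_addCircle hψ₀s.continuous
  have hφ₀f : (fun x : ℝ => φ₀ x) = ψ₀ := funext hφ₀
  have hφ₀e : ∀ θ, φ₀ (-θ) = φ₀ θ := fun θ => by
    induction θ using QuotientAddGroup.induction_on with | H x =>
    have := hψ₀e x
    rwa [← hφ₀, ← hφ₀, AddCircle.coe_neg] at this
  have h₀ : φ₀ = K ((1 / 4 - ω₀) • φ₀ + (1 / 2 : ℝ) • (φ₀ * φ₀) - A₀ • 1) := by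
    rw [hKR _ fun θ => by simp [hφ₀e]]
    refine eq_periodicResolvent_of_fourth_order_eq hm hm2 ?_ fun x => ?_
    · rw [hφ₀f]
      exact contDiff_infty.1 hψ₀s 4
    · rw [hφ₀f]
      simp only [ContinuousMap.sub_apply, ContinuousMap.add_apply, ContinuousMap.smul_apply,
        ContinuousMap.mul_apply, ContinuousMap.one_apply, smul_eq_mul, hφ₀]
      linear_combination heq x
  have hφ₀d : ∀ n, IsContDiffFamily (Set.univ : Set ℝ) n fun _ => φ₀ :=
    IsContDiffFamily.of_eq_periodicResolvent hm continuousOn_const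
      (fun n h => ((h.smul (c := fun _ => 1 / 4 - ω₀) continuousOn_const).add
        ((h.mul h).smul (c := fun _ => 1 / 2) continuousOn_const)).sub
          (IsContDiffFamily.smul_one (c := fun _ => A₀) continuousOn_const))
      (fun _ _ => h₀.trans (hKR _ fun θ => by simp [hφ₀e]))
  obtain ⟨O, hO, hmem, φ, hφc, hφ₀', hφ⟩ :=
    exists_continuousOn_branch_of_isCompactOperator K hK ω₀ A₀ φ₀ h₀ fun u hu => by
      have hue : ∀ θ, u (-θ) = u θ := fun θ => by rw [hu, hKeven]
      have huR := hu.trans (hKR _ fun θ => by simp [hφ₀e, hue])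
      have hud : ∀ n, IsContDiffFamily (Set.univ : Set ℝ) n fun _ => u :=
        IsContDiffFamily.of_eq_periodicResolvent hm continuousOn_const
          (fun n h => (h.smul (c := fun _ => 1 / 4 - ω₀) continuousOn_const).add
            ((hφ₀d n).mul h)) (fun _ _ => huR)
      have hu0 := hker (fun x : ℝ => u x)
        (contDiff_infty.2 fun n => (hud n).contDiff (Set.mem_univ 0))
        (fun x => hue x) (fun x => by simp) fun x => by
          have := fourth_order_eq_of_eq_periodicResolvent hm hm2 huR x
          simp only [ContinuousMap.add_apply, ContinuousMap.smul_apply,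
            ContinuousMap.mul_apply, smul_eq_mul, hφ₀] at this
          linear_combination this
      ext θ
      induction θ using QuotientAddGroup.induction_on with | H x =>
      exact hu0 x
  have hφe : ∀ p ∈ O, ∀ θ, φ p (-θ) = φ p θ := fun p hp θ => by rw [hφ p hp, hKeven]
  have hφR := fun p hp => (hφ p hp).trans (hKR _ fun θ => by simp [hφe p hp])
  have hφd : ∀ n, IsContDiffFamily O n φ :=
    IsContDiffFamily.of_eq_periodicResolvent hm hφc
      (fun n h => ((h.smul (c := fun p : ℝ × ℝ => 1 / 4 - p.1) (by fun_prop)).add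
        ((h.mul h).smul (c := fun _ => 1 / 2) continuousOn_const)).sub
          (IsContDiffFamily.smul_one (c := fun p : ℝ × ℝ => p.2) (by fun_prop))) hφR
  refine ⟨O, hO, hmem, fun p x => φ p x, by simpa only [hφ₀'] using hφ₀f,
    fun p hp => ⟨?_, ?_, ?_, ?_⟩, fun k => ?_⟩
  · exact contDiff_infty.2 fun n => (hφd n).contDiff hp
  · exact fun x => hφe p hp x
  · exact fun x => by simp
  · intro x
    have := fourth_order_eq_of_eq_periodicResolvent hm hm2 (hφR p hp) x
    simp only [ContinuousMap.sub_apply, ContinuousMap.add_apply, ContinuousMap.smul_apply,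
      ContinuousMap.mul_apply, ContinuousMap.one_apply, smul_eq_mul] at this
    linear_combination this
  · obtain ⟨D, hDc, hD⟩ := (hφd k).exists_iteratedDeriv
    exact ⟨fun p => circleToBounded (D p), hD, continuous_circleToBounded.comp_continuousOn hDc⟩
end
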